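/- There exists γ₀ > 0 such that for every γ with 0 < γ < γ₀ the following holds. Let α = 1/2, β = √3/2, let C_γ ⊆ ℝ³ be the convex hull of the twelve points (1,0,1+γ), (α,β,1−γ), (−α,β,1+γ), (−1,0,1−γ), (−α,−β,1+γ), (α,−β,1−γ), (1,0,−1+γ), (α,β,−1−γ), (−α,β,−1+γ), (−1,0,−1−γ), (−α,−β,−1+γ), (α,−β,−1−γ), and let Λ be the lattice with basis a₁ = (1+α, β, 0), a₂ = (1+α, −β, 0), a₃ = (0,0,2). If P is a closed convex set with P ⊆ C_γ and P + Λ is a tiling of ℝ³, then P = C_γ; in particular P must contain all twelve vertices of C_γ. -/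

import Mathlib

open Pointwise

/-- `C + L` is a (lattice) covering of the whole space: every point lies in `l + C`
for some `l ∈ L`. -/
def IsLatticeCovering {ι : Type*} (C L : Set (ι → ℝ)) : Prop :=
  ∀ x : ι → ℝ, ∃ l ∈ L, x ∈ l +ᵥ C

/-- `C + L` is a tiling of the whole space: it is a covering and the interiors of
distinct translates are pairwise disjoint. -/
def IsLatticeTiling {ι : Type*} [Fintype ι] (C L : Set (ι → ℝ)) : Prop :=
  IsLatticeCovering C L ∧
    ∀ l ∈ L, ∀ m ∈ L, l ≠ m → Disjoint (interior (l +ᵥ C)) (interior (m +ᵥ C))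

/-- A convex body: a compact convex set with nonempty interior. -/
def IsConvexBody {ι : Type*} [Fintype ι] (C : Set (ι → ℝ)) : Prop :=
  Convex ℝ C ∧ IsCompact C ∧ (interior C).Nonempty

noncomputable section

/-- The twelve vertices of the polytope `C_γ`, with `α = 1/2`, `β = √3/2`. -/
def vertexSet (γ : ℝ) : Set (Fin 3 → ℝ) :=
  {![1, 0, 1 + γ], ![1/2, Real.sqrt 3 / 2, 1 - γ], ![-(1/2), Real.sqrt 3 / 2, 1 + γ],
   ![-1, 0, 1 - γ], ![-(1/2), -(Real.sqrt 3 / 2), 1 + γ], ![1/2, -(Real.sqrt 3 / 2), 1 - γ],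
   ![1, 0, -1 + γ], ![1/2, Real.sqrt 3 / 2, -1 - γ], ![-(1/2), Real.sqrt 3 / 2, -1 + γ],
   ![-1, 0, -1 - γ], ![-(1/2), -(Real.sqrt 3 / 2), -1 + γ], ![1/2, -(Real.sqrt 3 / 2), -1 - γ]}

/-- The polytope `C_γ`: the convex hull of the twelve vertices. -/
def Cbody (γ : ℝ) : Set (Fin 3 → ℝ) :=
  convexHull ℝ (vertexSet γ)

/-- The lattice `Λ` with basis `a₁ = (1+α, β, 0)`, `a₂ = (1+α, −β, 0)`, `a₃ = (0,0,2)`,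
where `α = 1/2`, `β = √3/2`. -/
def latticeΛ : Set (Fin 3 → ℝ) :=
  {x | ∃ c₁ c₂ c₃ : ℤ, x = c₁ • ![1 + 1/2, Real.sqrt 3 / 2, 0] +
    c₂ • ![1 + 1/2, -(Real.sqrt 3 / 2), 0] + c₃ • ![0, 0, 2]}

end

/-- A linear inequality valid on the vertices is valid on `Cbody γ`. -/
theorem Cbody_linear_le {γ a b d c : ℝ}
    (h : ∀ v ∈ vertexSet γ, a * v 0 + b * v 1 + d * v 2 ≤ c) {p : Fin 3 → ℝ}
    (hp : p ∈ Cbody γ) : a * p 0 + b * p 1 + d * p 2 ≤ c := by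
  have hconv : Convex ℝ {p : Fin 3 → ℝ | a * p 0 + b * p 1 + d * p 2 ≤ c} := by
    refine convex_halfSpace_le (f := fun p : Fin 3 → ℝ => a * p 0 + b * p 1 + d * p 2)
      ⟨fun x y => ?_, fun k x => ?_⟩ c
    · simp only [Pi.add_apply]; ring
    · simp only [Pi.smul_apply, smul_eq_mul]; ring
  exact convexHull_min h hconv hp

/-- The hexagon with vertices the sixth roots of unity. -/
def InHexagon (x y : ℝ) : Prop :=
  |2 * y| ≤ √3 ∧ |√3 * x + y| ≤ √3 ∧ |√3 * x - y| ≤ √3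

theorem inHexagon_of_mem_Cbody {γ : ℝ} {p : Fin 3 → ℝ} (hp : p ∈ Cbody γ) :
    InHexagon (p 0) (p 1) := by
  have h0 : 0 ≤ √3 := Real.sqrt_nonneg 3
  have key : ∀ a b : ℝ, (∀ v ∈ vertexSet γ, a * v 0 + b * v 1 + 0 * v 2 ≤ √3) →
      a * p 0 + b * p 1 + 0 * p 2 ≤ √3 := fun a b h => Cbody_linear_le h hp
  have h1 := key 0 2 (by
    rintro v (h | h | h | h | h | h | h | h | h | h | h | h) <;> subst h <;> simp <;> linarith)
  have h2 := key 0 (-2) (by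
    rintro v (h | h | h | h | h | h | h | h | h | h | h | h) <;> subst h <;> simp <;> linarith)
  have h3 := key (√3) 1 (by
    rintro v (h | h | h | h | h | h | h | h | h | h | h | h) <;> subst h <;> simp <;> linarith)
  have h4 := key (-√3) (-1) (by
    rintro v (h | h | h | h | h | h | h | h | h | h | h | h) <;> subst h <;> simp <;> linarith)
  have h5 := key (√3) (-1) (by
    rintro v (h | h | h | h | h | h | h | h | h | h | h | h) <;> subst h <;> simp <;> linarith)
  have h6 := key (-√3) 1 (by
    rintro v (h | h | h | h | h | h | h | h | h | h | h | h) <;> subst h <;> simp <;> linarith)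
  refine ⟨abs_le.2 ⟨?_, ?_⟩, abs_le.2 ⟨?_, ?_⟩, abs_le.2 ⟨?_, ?_⟩⟩ <;> linarith

/-- A point of the open hexagon lies in only one lattice translate of the hexagon. -/
theorem InHexagon.translate_eq_zero {x y t : ℝ} (h : InHexagon x y) (ht : 0 < t) (ht1 : t ≤ 1)
    {c₁ c₂ : ℤ}
    (h' : InHexagon ((1 - t) * x - (c₁ + c₂) * (3 / 2)) ((1 - t) * y - (c₁ - c₂) * (√3 / 2))) :
    c₁ = 0 ∧ c₂ = 0 := by
  have h0 : 0 < √3 := Real.sqrt_pos.2 (by norm_num)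
  have key : ∀ (u : ℝ) (k : ℤ), |u| ≤ √3 → |(1 - t) * u - k * √3| ≤ √3 → -2 < k ∧ k < 2 := by
    intro u k hu hk
    rw [abs_le] at hu hk
    have e1 : (1 - t) * u ≤ (1 - t) * √3 := mul_le_mul_of_nonneg_left hu.2 (by linarith)
    have e2 : (1 - t) * (-√3) ≤ (1 - t) * u := mul_le_mul_of_nonneg_left hu.1 (by linarith)
    have e3 : 0 < t * √3 := mul_pos ht h0
    constructor
    · have : (-2 : ℝ) < k := by
        refine lt_of_mul_lt_mul_right (a := √3) ?_ h0.le
        linarith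
      exact_mod_cast this
    · have : (k : ℝ) < 2 := by
        refine lt_of_mul_lt_mul_right (a := √3) ?_ h0.le
        linarith
      exact_mod_cast this
  obtain ⟨h1, h2, h3⟩ := h
  obtain ⟨g1, g2, g3⟩ := h'
  have k1 := key _ (c₁ - c₂) h1 (by convert g1 using 2; push_cast; ring)
  have k2 := key _ (2 * c₁ + c₂) h2 (by convert g2 using 2; push_cast; ring)
  have k3 := key _ (c₁ + 2 * c₂) h3 (by convert g3 using 2; push_cast; ring)
  omega

/-- Over the open hexagon, each vertical line is covered by the vertical translates of `P`. -/
theorem IsLatticeCovering.exists_vertical {γ : ℝ} {P : Set (Fin 3 → ℝ)}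
    (hP : IsLatticeCovering P latticeΛ) (hPC : P ⊆ Cbody γ) {x y t : ℝ} (h : InHexagon x y)
    (ht : 0 < t) (ht1 : t ≤ 1) (z : ℝ) :
    ∃ c : ℤ, ![(1 - t) * x, (1 - t) * y, z - 2 * c] ∈ P := by
  obtain ⟨l, ⟨c₁, c₂, c₃, rfl⟩, hmem⟩ := hP ![(1 - t) * x, (1 - t) * y, z]
  rw [Set.mem_vadd_set_iff_neg_vadd_mem, vadd_eq_add] at hmem
  have hvec : -(c₁ • ![1 + 1/2, √3 / 2, 0] + c₂ • ![1 + 1/2, -(√3 / 2), 0] +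
      c₃ • ![(0 : ℝ), 0, 2]) + ![(1 - t) * x, (1 - t) * y, z] =
      ![(1 - t) * x - (c₁ + c₂) * (3 / 2), (1 - t) * y - (c₁ - c₂) * (√3 / 2), z - 2 * c₃] := by
    ext i
    fin_cases i <;> simp <;> ring
  rw [hvec] at hmem
  obtain ⟨rfl, rfl⟩ := h.translate_eq_zero ht ht1 (inHexagon_of_mem_Cbody (hPC hmem))
  exact ⟨c₃, by simpa using hmem⟩

/-- If near `(x, y)` the body `Cbody γ` has height barely more than `2`, centred at `s`, then
a closed covering subset contains both end points of the fibre over `(x, y)`. -/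
theorem IsLatticeCovering.endpoints_mem {γ : ℝ} (hγ : 0 < γ) (hγ1 : γ < 1) {P : Set (Fin 3 → ℝ)}
    (hcl : IsClosed P) (hP : IsLatticeCovering P latticeΛ) (hPC : P ⊆ Cbody γ) {x y s : ℝ}
    (h : InHexagon x y) (hxy : x * x + y * y = 1)
    (hs : ∀ v ∈ vertexSet γ, |v 2 - s| ≤ 1 + 4 * γ * (1 - (x * v 0 + y * v 1))) :
    ![x, y, s + 1] ∈ P ∧ ![x, y, s - 1] ∈ P := by
  have hb : ∀ t z : ℝ, ![(1 - t) * x, (1 - t) * y, z] ∈ P →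
      z - s ≤ 1 + 4 * γ * t ∧ -(1 + 4 * γ * t) ≤ z - s := by
    intro t z hz
    have b1 := Cbody_linear_le (γ := γ) (a := 4 * γ * x) (b := 4 * γ * y) (d := 1)
      (c := 1 + 4 * γ + s) (fun v hv => by linarith [(abs_le.1 (hs v hv)).2]) (hPC hz)
    have b2 := Cbody_linear_le (γ := γ) (a := 4 * γ * x) (b := 4 * γ * y) (d := -1)
      (c := 1 + 4 * γ - s) (fun v hv => by linarith [(abs_le.1 (hs v hv)).1]) (hPC hz)
    have e : 4 * γ * x * ((1 - t) * x) + 4 * γ * y * ((1 - t) * y) = 4 * γ * (1 - t) := by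
      linear_combination 4 * γ * (1 - t) * hxy
    simp only [Matrix.cons_val_zero, Matrix.cons_val_one, Matrix.cons_val] at b1 b2
    constructor <;> linarith
  have mem : ∀ t : ℝ, 0 < t → t < 1 / 10 →
      ![(1 - t) * x, (1 - t) * y, s + 1 - 5 * γ * t] ∈ P ∧
      ![(1 - t) * x, (1 - t) * y, s - 1 + 5 * γ * t] ∈ P := by
    intro t ht ht1
    have hγt : 0 < γ * t := mul_pos hγ ht
    have hγt1 : γ * t < 1 / 10 := by nlinarith
    constructor
    · obtain ⟨c, hc⟩ := hP.exists_vertical hPC h ht (by linarith) (s + 1 - 5 * γ * t)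
      obtain ⟨b1, b2⟩ := hb t _ hc
      have l1 : (c : ℝ) < 1 := by linarith
      have l2 : (-1 : ℝ) < c := by linarith
      have l1' : c < 1 := by exact_mod_cast l1
      have l2' : -1 < c := by exact_mod_cast l2
      obtain rfl : c = 0 := by omega
      simpa using hc
    · obtain ⟨c, hc⟩ := hP.exists_vertical hPC h ht (by linarith) (s - 1 + 5 * γ * t)
      obtain ⟨b1, b2⟩ := hb t _ hc
      have l1 : (c : ℝ) < 1 := by linarith
      have l2 : (-1 : ℝ) < c := by linarith
      have l1' : c < 1 := by exact_mod_cast l1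
      have l2' : -1 < c := by exact_mod_cast l2
      obtain rfl : c = 0 := by omega
      simpa using hc
  have hev : ∀ᶠ t : ℝ in nhdsWithin 0 (Set.Ioi 0), 0 < t ∧ t < 1 / 10 :=
    Ioo_mem_nhdsGT (by norm_num)
  have lim : ∀ z k : ℝ, Filter.Tendsto
      (fun t : ℝ => ![(1 - t) * x, (1 - t) * y, z + k * t]) (nhdsWithin 0 (Set.Ioi 0))
      (nhds ![x, y, z]) := by
    intro z k
    have hc : Continuous fun t : ℝ => ![(1 - t) * x, (1 - t) * y, z + k * t] := by
      refine continuous_pi fun i => ?_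
      fin_cases i <;> simp <;> fun_prop
    simpa using (hc.tendsto 0).mono_left nhdsWithin_le_nhds
  constructor
  · refine hcl.mem_of_tendsto (lim (s + 1) (-(5 * γ))) (hev.mono fun t ht => ?_)
    convert (mem t ht.1 ht.2).1 using 4
    ring
  · exact hcl.mem_of_tendsto (lim (s - 1) (5 * γ)) (hev.mono fun t ht => (mem t ht.1 ht.2).2)

/-- A closed subset of `Cbody γ` whose lattice translates cover space contains every vertex. -/
theorem IsLatticeCovering.vertexSet_subset {γ : ℝ} (hγ : 0 < γ) (hγ1 : γ < 1)
    {P : Set (Fin 3 → ℝ)} (hcl : IsClosed P) (hP : IsLatticeCovering P latticeΛ)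
    (hPC : P ⊆ Cbody γ) : vertexSet γ ⊆ P := by
  have hr : √3 * √3 = 3 := Real.mul_self_sqrt (by norm_num)
  have hγr : γ * (√3 * √3) = γ * 3 := by rw [hr]
  have h0 : 0 ≤ √3 := Real.sqrt_nonneg 3
  have main : ∀ x y s : ℝ, InHexagon x y → x * x + y * y = 1 →
      (∀ v ∈ vertexSet γ, |v 2 - s| ≤ 1 + 4 * γ * (1 - (x * v 0 + y * v 1))) →
      ![x, y, s + 1] ∈ P ∧ ![x, y, s - 1] ∈ P := fun x y s h1 h2 h3 =>
    hP.endpoints_mem hγ hγ1 hcl hPC h1 h2 h3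
  have m1 := main 1 0 γ
    (by refine ⟨?_, ?_, ?_⟩ <;> rw [abs_le] <;> constructor <;> linarith)
    (by linarith) (by
      rintro v (h | h | h | h | h | h | h | h | h | h | h | h) <;> subst h <;>
        rw [abs_le] <;> constructor <;>
        simp only [Matrix.cons_val_zero, Matrix.cons_val_one, Matrix.cons_val] <;> linarith)
  have m2 := main (1 / 2) (√3 / 2) (-γ)
    (by refine ⟨?_, ?_, ?_⟩ <;> rw [abs_le] <;> constructor <;> linarith)
    (by linarith) (by
      rintro v (h | h | h | h | h | h | h | h | h | h | h | h) <;> subst h <;>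
        rw [abs_le] <;> constructor <;>
        simp only [Matrix.cons_val_zero, Matrix.cons_val_one, Matrix.cons_val] <;> linarith)
  have m3 := main (-(1 / 2)) (√3 / 2) γ
    (by refine ⟨?_, ?_, ?_⟩ <;> rw [abs_le] <;> constructor <;> linarith)
    (by linarith) (by
      rintro v (h | h | h | h | h | h | h | h | h | h | h | h) <;> subst h <;>
        rw [abs_le] <;> constructor <;>
        simp only [Matrix.cons_val_zero, Matrix.cons_val_one, Matrix.cons_val] <;> linarith)
  have m4 := main (-1) 0 (-γ)
    (by refine ⟨?_, ?_, ?_⟩ <;> rw [abs_le] <;> constructor <;> linarith)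
    (by linarith) (by
      rintro v (h | h | h | h | h | h | h | h | h | h | h | h) <;> subst h <;>
        rw [abs_le] <;> constructor <;>
        simp only [Matrix.cons_val_zero, Matrix.cons_val_one, Matrix.cons_val] <;> linarith)
  have m5 := main (-(1 / 2)) (-(√3 / 2)) γ
    (by refine ⟨?_, ?_, ?_⟩ <;> rw [abs_le] <;> constructor <;> linarith)
    (by linarith) (by
      rintro v (h | h | h | h | h | h | h | h | h | h | h | h) <;> subst h <;>
        rw [abs_le] <;> constructor <;>
        simp only [Matrix.cons_val_zero, Matrix.cons_val_one, Matrix.cons_val] <;> linarith)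
  have m6 := main (1 / 2) (-(√3 / 2)) (-γ)
    (by refine ⟨?_, ?_, ?_⟩ <;> rw [abs_le] <;> constructor <;> linarith)
    (by linarith) (by
      rintro v (h | h | h | h | h | h | h | h | h | h | h | h) <;> subst h <;>
        rw [abs_le] <;> constructor <;>
        simp only [Matrix.cons_val_zero, Matrix.cons_val_one, Matrix.cons_val] <;> linarith)
  rintro v (h | h | h | h | h | h | h | h | h | h | h | h) <;> subst h
  · convert m1.1 using 4; ring
  · convert m2.1 using 4; ring
  · convert m3.1 using 4; ring
  · convert m4.1 using 4; ring
  · convert m5.1 using 4; ring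
  · convert m6.1 using 4; ring
  · convert m1.2 using 4; ring
  · convert m2.2 using 4; ring
  · convert m3.2 using 4; ring
  · convert m4.2 using 4; ring
  · convert m5.2 using 4; ring
  · convert m6.2 using 4; ring

/-- For all sufficiently small `γ > 0`: if `P` is a closed convex set with `P ⊆ C_γ`
and `P + Λ` is a tiling of `ℝ³`, then `P = C_γ`; in particular `P` contains all
twelve vertices of `C_γ`. -/
theorem Cbody_tiling_subset_eq :
    ∃ γ₀ > (0 : ℝ), ∀ γ : ℝ, 0 < γ → γ < γ₀ →
      ∀ P : Set (Fin 3 → ℝ), IsClosed P → Convex ℝ P → P ⊆ Cbody γ →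
        IsLatticeTiling P latticeΛ → P = Cbody γ ∧ vertexSet γ ⊆ P := by
  refine ⟨1, one_pos, fun γ hγ hγ1 P hcl hconv hPC hP => ?_⟩
  have hv := hP.1.vertexSet_subset hγ hγ1 hcl hPC
  exact ⟨hPC.antisymm (convexHull_min hv hconv), hv⟩
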